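/- arXiv:1607.00956 — 2 statements merged into one kernel-verified Lean document; each statement's English description precedes it below -/
import Mathlib

section
/- Fix Hamiltonians H0, H1 : X → ℝ, define the nonequilibrium free energy F(H, p) = Σ_x p(x) H(x) − S(p) (in units with kT = 1), the expected work ⟨W⟩_p = W_d(p) + F(H1, pP) − F(H0, p), and the cross-entropy C(p‖q) = −Σ_x p(x) ln q(x). Suppose q0 is a probability distribution on X with full support that minimizes W_d over all probability distributions on X and that W_d(q0) = 0. Then for every probability distribution r0 on X, ⟨W⟩_{r0} = Σ_x (r0P)(x) H1(x) − Σ_x r0(x) H0(x) + C(r0‖q0) − C(r0P‖q0P). -/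
open Finset

/-- `p` is a probability distribution on the finite set `X`. -/
def IsProb {X : Type*} [Fintype X] (p : X → ℝ) : Prop :=
  (∀ x, 0 ≤ p x) ∧ ∑ x, p x = 1

/-- `P` is a row-stochastic kernel on `X`; `P x0 x1` denotes `P(x1|x0)`. -/
def IsKernel {X : Type*} [Fintype X] (P : X → X → ℝ) : Prop :=
  (∀ x0 x1, 0 ≤ P x0 x1) ∧ ∀ x0, ∑ x1, P x0 x1 = 1

/-- Push-forward of `p` under the kernel `P`: `(pP)(x1) = Σ_{x0} p(x0) P(x1|x0)`. -/
def push {X : Type*} [Fintype X] (P : X → X → ℝ) (p : X → ℝ) : X → ℝ :=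
  fun x1 => ∑ x0, p x0 * P x0 x1

/-- Shannon entropy with natural logarithm (`Real.log 0 = 0` gives the `0 ln 0 = 0` convention). -/
noncomputable def shannon {X : Type*} [Fintype X] (p : X → ℝ) : ℝ :=
  -∑ x, p x * Real.log (p x)

/-- Dissipation functional `W_d(p) = S(pP) − S(p) − Σ_x p(x) Q(x)`. -/
noncomputable def Wd {X : Type*} [Fintype X] (P : X → X → ℝ) (Q : X → ℝ) (p : X → ℝ) : ℝ :=
  shannon (push P p) - shannon p - ∑ x, p x * Q x

/-- Kullback–Leibler divergence `D(r‖q) = Σ_x r(x) ln(r(x)/q(x))`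
(terms with `r x = 0` vanish since `0 * log _ = 0`). -/
noncomputable def KL {X : Type*} [Fintype X] (r q : X → ℝ) : ℝ :=
  ∑ x, r x * Real.log (r x / q x)

/-- Nonequilibrium free energy `F(H, p) = Σ_x p(x) H(x) − S(p)` (units with `kT = 1`). -/
noncomputable def freeEnergy {X : Type*} [Fintype X] (H p : X → ℝ) : ℝ :=
  (∑ x, p x * H x) - shannon p

/-- Cross-entropy `C(p‖q) = −Σ_x p(x) ln q(x)`. -/
noncomputable def crossEnt {X : Type*} [Fintype X] (p q : X → ℝ) : ℝ :=
  -∑ x, p x * Real.log (q x)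

/-- Derivative of the Shannon entropy along a line with mass-preserving direction `d`
supported in the support of the base point `q`. -/
lemma hasDerivAt_shannon_line {X : Type*} [Fintype X] (q d : X → ℝ)
    (hd : ∑ x, d x = 0) (hqd : ∀ x, q x = 0 → d x = 0) :
    HasDerivAt (fun t : ℝ => shannon (fun x => q x + t * d x)) (crossEnt d q) 0 := by
  have key : ∀ x, HasDerivAt (fun t : ℝ => (q x + t * d x) * Real.log (q x + t * d x))
      ((Real.log (q x) + 1) * d x) 0 := by
    intro x
    by_cases hx : q x = 0
    · simpa [hx, hqd x hx] using hasDerivAt_const (0 : ℝ) (0 : ℝ)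
    · have hline : HasDerivAt (fun t : ℝ => q x + t * d x) (d x) 0 := by
        simpa using ((hasDerivAt_id (0 : ℝ)).mul_const (d x)).const_add (q x)
      have hlog : HasDerivAt (fun y : ℝ => y * Real.log y) (Real.log (q x) + 1)
          (q x + 0 * d x) := by
        simpa using Real.hasDerivAt_mul_log hx
      exact hlog.comp (0 : ℝ) hline
  have hsum := (HasDerivAt.fun_sum (u := Finset.univ) fun x _ => key x).fun_neg
  have hval : crossEnt d q = -∑ x, (Real.log (q x) + 1) * d x := by
    simp only [crossEnt, add_mul, one_mul, Finset.sum_add_distrib, hd, add_zero,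
      mul_comm (Real.log _)]
  rw [hval]
  exact hsum

lemma push_add_mul {X : Type*} [Fintype X] (P : X → X → ℝ) (q d : X → ℝ) (t : ℝ) :
    push P (fun x => q x + t * d x) = fun y => push P q y + t * push P d y := by
  funext y
  simp only [push, add_mul, Finset.sum_add_distrib, Finset.mul_sum, mul_assoc]

lemma push_sub {X : Type*} [Fintype X] (P : X → X → ℝ) (r q : X → ℝ) (y : X) :
    push P (fun x => r x - q x) y = push P r y - push P q y := by
  simp only [push, sub_mul, Finset.sum_sub_distrib]

lemma sum_push {X : Type*} [Fintype X] {P : X → X → ℝ} (hP : IsKernel P) (p : X → ℝ) :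
    ∑ y, push P p y = ∑ x, p x := by
  simp only [push]
  rw [Finset.sum_comm]
  simp only [← Finset.mul_sum, hP.2, mul_one]

lemma push_eq_zero_of_pos {X : Type*} [Fintype X] {P : X → X → ℝ} (hP : IsKernel P)
    {q : X → ℝ} (hq : ∀ x, 0 < q x) (d : X → ℝ) (y : X) (hy : push P q y = 0) :
    push P d y = 0 := by
  have h := (Finset.sum_eq_zero_iff_of_nonneg
    fun x _ => mul_nonneg (hq x).le (hP.1 x y)).1 hy
  refine Finset.sum_eq_zero fun x hx => ?_
  rw [(mul_eq_zero.1 (h x hx)).resolve_left (hq x).ne', mul_zero]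

lemma crossEnt_sub {X : Type*} [Fintype X] (r p q : X → ℝ) :
    crossEnt (fun x => r x - p x) q = crossEnt r q - crossEnt p q := by
  simp only [crossEnt, sub_mul, Finset.sum_sub_distrib]
  ring

lemma hasDerivAt_Wd_line {X : Type*} [Fintype X] {P : X → X → ℝ} (hP : IsKernel P)
    (Q : X → ℝ) {q : X → ℝ} (hq : ∀ x, 0 < q x) (d : X → ℝ) (hd : ∑ x, d x = 0) :
    HasDerivAt (fun t : ℝ => Wd P Q (fun x => q x + t * d x))
      (crossEnt (push P d) (push P q) - crossEnt d q - ∑ x, d x * Q x) 0 := by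
  have hpush := hasDerivAt_shannon_line (push P q) (push P d) ((sum_push hP d).trans hd)
    (push_eq_zero_of_pos hP hq d)
  have hbase := hasDerivAt_shannon_line q d hd fun x hx => absurd hx (hq x).ne'
  have hheat : HasDerivAt (fun t : ℝ => ∑ x, (q x + t * d x) * Q x) (∑ x, d x * Q x) 0 := by
    refine HasDerivAt.fun_sum fun x _ => ?_
    simpa using (((hasDerivAt_id (0 : ℝ)).mul_const (d x)).const_add (q x)).mul_const (Q x)
  simp only [Wd, push_add_mul]
  exact (hpush.fun_sub hbase).fun_sub hheat

/-- A full-support minimizer of the dissipation is stationary in every mass-preserving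
direction. -/
lemma Wd_stationary {X : Type*} [Fintype X] {P : X → X → ℝ} (hP : IsKernel P)
    (Q : X → ℝ) {q : X → ℝ} (hq : IsProb q) (hqfull : ∀ x, 0 < q x)
    (hmin : ∀ p : X → ℝ, IsProb p → Wd P Q q ≤ Wd P Q p)
    (d : X → ℝ) (hd : ∑ x, d x = 0) :
    crossEnt (push P d) (push P q) - crossEnt d q - ∑ x, d x * Q x = 0 := by
  refine IsLocalMin.hasDerivAt_eq_zero ?_ (hasDerivAt_Wd_line hP Q hqfull d hd)
  have hpos : ∀ᶠ t : ℝ in nhds 0, ∀ x, 0 < q x + t * d x := by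
    refine Filter.eventually_all.2 fun x => ?_
    have hc : ContinuousAt (fun t : ℝ => q x + t * d x) 0 := by fun_prop
    exact hc.eventually_const_lt (by simpa using hqfull x)
  filter_upwards [hpos] with t ht
  have h := hmin (fun x => q x + t * d x) ⟨fun x => (ht x).le, by
    rw [Finset.sum_add_distrib, ← Finset.mul_sum, hd, hq.2]; ring⟩
  simpa using h

/-- If the full-support minimizer `q0` achieves zero dissipation, then
the expected work `⟨W⟩_{r0} = W_d(r0) + F(H1, r0 P) − F(H0, r0)` equals
`⟨H1⟩_{r1} − ⟨H0⟩_{r0} + C(r0‖q0) − C(r1‖q1)`. -/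
theorem expected_work_cross_entropy {X : Type*} [Fintype X] [Nonempty X]
    (P : X → X → ℝ) (Q : X → ℝ) (hP : IsKernel P)
    (H0 H1 : X → ℝ)
    (q0 : X → ℝ) (hq : IsProb q0) (hqfull : ∀ x, 0 < q0 x)
    (hmin : ∀ p : X → ℝ, IsProb p → Wd P Q q0 ≤ Wd P Q p)
    (hzero : Wd P Q q0 = 0)
    (r0 : X → ℝ) (hr : IsProb r0) :
    Wd P Q r0 + freeEnergy H1 (push P r0) - freeEnergy H0 r0
      = (∑ x, push P r0 x * H1 x) - (∑ x, r0 x * H0 x)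
        + crossEnt r0 q0 - crossEnt (push P r0) (push P q0) := by
  have hstat := Wd_stationary hP Q hq hqfull hmin (fun x => r0 x - q0 x)
    (by rw [Finset.sum_sub_distrib, hr.2, hq.2, sub_self])
  have hpush : push P (fun x => r0 x - q0 x) = fun y => push P r0 y - push P q0 y :=
    funext (push_sub P r0 q0)
  rw [hpush, crossEnt_sub, crossEnt_sub] at hstat
  simp only [sub_mul, Finset.sum_sub_distrib] at hstat
  have hself : ∀ p : X → ℝ, crossEnt p p = shannon p := fun _ => rfl
  rw [hself, hself] at hstat
  simp only [Wd] at hzero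
  simp only [Wd, freeEnergy]
  linarith
end

section
/- Suppose q0 is a probability distribution on X with full support that minimizes the dissipation functional W_d over all probability distributions on X, that W_d(q0) = 0, and that q0 is stationary for the kernel: q0P = q0. Then for every probability distribution r0 on X, W_d(r0) = D(r0‖q0) − D(r0P‖q0); in particular W_d(r0) ≥ 0 for all r0. -/
open Finset

/-- A push-forward of a probability distribution under a kernel is a probability distribution. -/
theorem IsProb.push {X : Type*} [Fintype X] {P : X → X → ℝ} {p : X → ℝ}
    (hp : IsProb p) (hP : IsKernel P) : IsProb (push P p) := by
  refine ⟨fun y => Finset.sum_nonneg fun x _ => mul_nonneg (hp.1 x) (hP.1 x y), ?_⟩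
  simp only [_root_.push]
  rw [Finset.sum_comm]
  simp [← Finset.mul_sum, hP.2, hp.2]

/-- Gibbs' inequality. -/
theorem KL_nonneg {X : Type*} [Fintype X] {p q : X → ℝ} (hp : IsProb p) (hq : IsProb q)
    (hpos : ∀ x, 0 < q x) : 0 ≤ KL p q := by
  have h : ∑ x, (p x - q x) ≤ KL p q := by
    refine Finset.sum_le_sum fun x _ => ?_
    rcases (hp.1 x).eq_or_lt with h0 | h0
    · simp [← h0, (hpos x).le]
    · have h1 := Real.one_sub_inv_le_log_of_pos (div_pos h0 (hpos x))
      calc p x - q x = p x * (1 - (p x / q x)⁻¹) := by field_simp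
        _ ≤ _ := mul_le_mul_of_nonneg_left h1 h0.le
  simpa [Finset.sum_sub_distrib, hp.2, hq.2] using h

/-- The Kullback–Leibler divergence is bounded by the chi-squared divergence. -/
theorem KL_le_chiSq {X : Type*} [Fintype X] {p q : X → ℝ} (hp : IsProb p) (hq : IsProb q)
    (hpos : ∀ x, 0 < q x) : KL p q ≤ ∑ x, (p x - q x) ^ 2 / q x := by
  have h : KL p q ≤ ∑ x, ((p x - q x) ^ 2 / q x + (p x - q x)) := by
    refine Finset.sum_le_sum fun x _ => ?_
    have hx := (hpos x).ne'
    have heq : (p x - q x) ^ 2 / q x + (p x - q x) = p x * (p x / q x - 1) := by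
      field_simp
      ring
    rw [heq]
    rcases (hp.1 x).eq_or_lt with h0 | h0
    · simp [← h0]
    · exact mul_le_mul_of_nonneg_left
        (Real.log_le_sub_one_of_pos (div_pos h0 (hpos x))) h0.le
  simpa [Finset.sum_add_distrib, Finset.sum_sub_distrib, hp.2, hq.2] using h

theorem KL_eq_neg_shannon_sub {X : Type*} [Fintype X] (p : X → ℝ) {q : X → ℝ}
    (hpos : ∀ x, 0 < q x) : KL p q = -shannon p - ∑ x, p x * Real.log (q x) := by
  simp only [KL, shannon, neg_neg, ← Finset.sum_sub_distrib]
  refine Finset.sum_congr rfl fun x _ => ?_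
  by_cases h0 : p x = 0
  · simp [h0]
  · rw [Real.log_div h0 (hpos x).ne']
    ring

theorem sum_push_mul {X : Type*} [Fintype X] (P : X → X → ℝ) (p f : X → ℝ) :
    ∑ y, push P p y * f y = ∑ x, p x * ∑ y, P x y * f y := by
  simp only [push, Finset.sum_mul, Finset.mul_sum]
  rw [Finset.sum_comm]
  simp only [mul_assoc]

/-- The dissipation differs from the drop in divergence to `q` by a functional linear in `p`. -/
theorem Wd_eq_KL_sub_KL_add {X : Type*} [Fintype X] (P : X → X → ℝ) (Q p : X → ℝ) {q : X → ℝ}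
    (hpos : ∀ x, 0 < q x) :
    Wd P Q p = KL p q - KL (push P p) q +
      ∑ x, p x * (Real.log (q x) - (∑ y, P x y * Real.log (q y)) - Q x) := by
  simp only [mul_sub, Finset.sum_sub_distrib]
  rw [KL_eq_neg_shannon_sub p hpos, KL_eq_neg_shannon_sub (push P p) hpos, sum_push_mul, Wd]
  ring

theorem nonneg_of_forall_nonneg_mul_add_sq {A C : ℝ} (hC : 0 ≤ C)
    (h : ∀ t, 0 < t → t ≤ 1 → 0 ≤ t * A + t ^ 2 * C) : 0 ≤ A := by
  by_contra! hA
  have hd : 0 < C - A := by linarith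
  have ht : 0 < -A / (C - A) := div_pos (by linarith) hd
  have h1 := h _ ht ((div_le_one hd).2 (by linarith))
  have h2 : -A / (C - A) * A + (-A / (C - A)) ^ 2 * C = -(-A / (C - A)) ^ 2 * -A := by
    field_simp
    ring
  rw [h2] at h1
  nlinarith [mul_pos (pow_pos ht 2) (neg_pos.2 hA)]

theorem IsProb.add_mul_sub {X : Type*} [Fintype X] {q r : X → ℝ} (hq : IsProb q)
    (hr : IsProb r) {t : ℝ} (ht : 0 ≤ t) (ht1 : t ≤ 1) :
    IsProb fun x => q x + t * (r x - q x) := by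
  refine ⟨fun x => ?_, ?_⟩
  · nlinarith [mul_nonneg ht (hr.1 x), mul_nonneg (sub_nonneg.2 ht1) (hq.1 x)]
  · simp [Finset.sum_add_distrib, ← Finset.mul_sum, Finset.sum_sub_distrib, hq.2, hr.2]

theorem isProb_single {X : Type*} [Fintype X] [DecidableEq X] (a : X) :
    IsProb (Pi.single a (1 : ℝ)) := by
  refine ⟨fun x => ?_, by simp⟩
  by_cases h : x = a
  · subst h
    simp
  · simp [h]

/-- If the full-support minimizer `q0` achieves zero dissipation and is
stationary for the kernel (`q0 P = q0`), then `W_d(r0) = D(r0‖q0) − D(r0P‖q0)` for every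
`r0`; in particular dissipation is nonnegative. -/
theorem dissipation_for_stationary_prior {X : Type*} [Fintype X] [Nonempty X]
    (P : X → X → ℝ) (Q : X → ℝ) (hP : IsKernel P)
    (q0 : X → ℝ) (hq : IsProb q0) (hqfull : ∀ x, 0 < q0 x)
    (hmin : ∀ p : X → ℝ, IsProb p → Wd P Q q0 ≤ Wd P Q p)
    (hzero : Wd P Q q0 = 0) (hstat : push P q0 = q0) :
    ∀ r0 : X → ℝ, IsProb r0 →
      (Wd P Q r0 = KL r0 q0 - KL (push P r0) q0 ∧ 0 ≤ Wd P Q r0) := by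
  classical
  let L : X → ℝ := fun x => Real.log (q0 x) - (∑ y, P x y * Real.log (q0 y)) - Q x
  have hW : ∀ p, Wd P Q p = KL p q0 - KL (push P p) q0 + ∑ x, p x * L x :=
    fun p => Wd_eq_KL_sub_KL_add P Q p hqfull
  have hq0L : ∑ x, q0 x * L x = 0 := by
    have h := hW q0
    rw [hstat, hzero] at h
    linarith
  have hnonneg : ∀ r, IsProb r → 0 ≤ ∑ x, r x * L x := by
    intro r hr
    refine nonneg_of_forall_nonneg_mul_add_sq (C := ∑ x, (r x - q0 x) ^ 2 / q0 x)
      (Finset.sum_nonneg fun x _ => div_nonneg (sq_nonneg _) (hqfull x).le) fun t ht ht1 => ?_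
    have hp := hq.add_mul_sub hr ht.le ht1
    have hlin : ∑ x, (q0 x + t * (r x - q0 x)) * L x = t * ∑ x, r x * L x := by
      calc _ = (1 - t) * ∑ x, q0 x * L x + t * ∑ x, r x * L x := by
            simp only [Finset.mul_sum, ← Finset.sum_add_distrib]
            exact Finset.sum_congr rfl fun x _ => by ring
        _ = _ := by rw [hq0L]; ring
    have hchi : ∑ x, (q0 x + t * (r x - q0 x) - q0 x) ^ 2 / q0 x =
        t ^ 2 * ∑ x, (r x - q0 x) ^ 2 / q0 x := by
      rw [Finset.mul_sum]
      exact Finset.sum_congr rfl fun x _ => by ring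
    have h1 := hmin _ hp
    rw [hzero, hW, hlin] at h1
    have h2 := KL_nonneg (hp.push hP) hq hqfull
    have h3 := KL_le_chiSq hp hq hqfull
    rw [hchi] at h3
    linarith
  have hLnonneg : ∀ x, 0 ≤ L x := fun x => by
    simpa [Pi.single_apply] using hnonneg _ (isProb_single x)
  have hLzero : ∀ x, L x = 0 := fun x => by
    have h := (Finset.sum_eq_zero_iff_of_nonneg
      fun x _ => mul_nonneg (hqfull x).le (hLnonneg x)).1 hq0L x (Finset.mem_univ x)
    exact (mul_eq_zero.1 h).resolve_left (hqfull x).ne'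
  intro r0 hr0
  refine ⟨by simp [hW, hLzero], ?_⟩
  rw [← hzero]
  exact hmin r0 hr0
end
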